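/- arXiv:physics/9612013 — 6 statements merged into one kernel-verified Lean document; each statement's English description precedes it below -/
import Mathlib

section
/- Laman's theorem. Let (G,p) be a bar-joint framework in the plane with generic realization p. Then the edges of G are independent (i.e., the rigidity functionals r_{ij} of all edges are linearly independent) if and only if for every nonempty subset E' of the edges, |E'| ≤ 2n' − 3, where n' is the number of vertices incident to some edge of E'. -/
open scoped Classical

set_option linter.unusedSectionVars false

noncomputable section

/-- Dot product on `ℝ × ℝ`. -/
def dot (x y : ℝ × ℝ) : ℝ := x.1 * y.1 + x.2 * y.2

variable {V : Type*} [Fintype V] [DecidableEq V]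

/-- The rigidity functional `r_{ij}(v) = (p i − p j)·(v i − v j)` of an (unordered) edge,
viewed as a functional on the space of velocity assignments. -/
def edgeFun (p : V → ℝ × ℝ) : Sym2 V → ((V → ℝ × ℝ) → ℝ) :=
  Sym2.lift ⟨fun i j => fun v => dot (p i - p j) (v i - v j), by
    intro i j
    funext v
    simp [dot]
    ring⟩

lemma edgeFun_add (p : V → ℝ × ℝ) (e : Sym2 V) (v w : V → ℝ × ℝ) :
    edgeFun p e (v + w) = edgeFun p e v + edgeFun p e w := by
  induction e using Sym2.ind with
  | _ i j =>
    simp [edgeFun, dot]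
    ring

lemma edgeFun_smul (p : V → ℝ × ℝ) (e : Sym2 V) (c : ℝ) (v : V → ℝ × ℝ) :
    edgeFun p e (c • v) = c * edgeFun p e v := by
  induction e using Sym2.ind with
  | _ i j =>
    simp [edgeFun, dot, smul_sub]
    ring

lemma edgeFun_zero (p : V → ℝ × ℝ) (e : Sym2 V) :
    edgeFun p e 0 = 0 := by
  induction e using Sym2.ind with
  | _ i j =>
    simp [edgeFun, dot]

/-- The space of infinitesimal flexes of the framework `(G, p)`. -/
def flexSpace (G : SimpleGraph V) (p : V → ℝ × ℝ) : Submodule ℝ (V → ℝ × ℝ) where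
  carrier := {v | ∀ e ∈ G.edgeSet, edgeFun p e v = 0}
  add_mem' := by
    intro v w hv hw e he
    rw [edgeFun_add, hv e he, hw e he, add_zero]
  zero_mem' := by
    intro e _
    exact edgeFun_zero p e
  smul_mem' := by
    intro c v hv e he
    rw [edgeFun_smul, hv e he, mul_zero]

/-- A framework is infinitesimally rigid if its space of infinitesimal flexes is
exactly 3-dimensional. -/
def InfinitesimallyRigid (G : SimpleGraph V) (p : V → ℝ × ℝ) : Prop :=
  Module.finrank ℝ (flexSpace G p) = 3

/-- A realization is generic if the `2|V|` coordinates of the points are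
algebraically independent over `ℚ`. -/
def GenericRealization (p : V → ℝ × ℝ) : Prop :=
  AlgebraicIndependent ℚ (Sum.elim (fun i => (p i).1) (fun i => (p i).2) : V ⊕ V → ℝ)

/-- The set of vertices incident to some edge of `E'`. -/
def spannedVerts (E' : Finset (Sym2 V)) : Finset V :=
  Finset.univ.filter (fun i => ∃ e ∈ E', i ∈ e)

/-! ### Rigidity functionals -/

lemma edgeFun_mk (p : V → ℝ × ℝ) (i j : V) (v : V → ℝ × ℝ) :
    edgeFun p s(i, j) v = dot (p i - p j) (v i - v j) := rfl

lemma edgeFun_congr_left {p q : V → ℝ × ℝ} {e : Sym2 V} (h : ∀ i ∈ e, p i = q i) :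
    edgeFun p e = edgeFun q e := by
  induction e using Sym2.ind with
  | _ i j =>
    funext v
    simp only [edgeFun_mk, h i (Sym2.mem_mk_left i j), h j (Sym2.mem_mk_right i j)]

lemma edgeFun_congr_right (p : V → ℝ × ℝ) {e : Sym2 V} {v w : V → ℝ × ℝ}
    (h : ∀ i ∈ e, v i = w i) : edgeFun p e v = edgeFun p e w := by
  induction e using Sym2.ind with
  | _ i j =>
    simp only [edgeFun_mk, h i (Sym2.mem_mk_left i j), h j (Sym2.mem_mk_right i j)]

lemma edgeFun_single_of_notMem (p : V → ℝ × ℝ) {e : Sym2 V} {k : V} (h : k ∉ e) (w : ℝ × ℝ) :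
    edgeFun p e (Pi.single k w) = 0 := by
  rw [← edgeFun_zero p e]
  refine edgeFun_congr_right p fun i hi => ?_
  have : i ≠ k := fun hik => h (hik ▸ hi)
  simp [this]

lemma edgeFun_single (p : V → ℝ × ℝ) {k u : V} (h : u ≠ k) (w : ℝ × ℝ) :
    edgeFun p s(k, u) (Pi.single k w) = dot (p k - p u) w := by
  simp [edgeFun_mk, h]

lemma edgeFun_sum (p : V → ℝ × ℝ) (e : Sym2 V) {ι : Type*} (s : Finset ι)
    (f : ι → V → ℝ × ℝ) : edgeFun p e (∑ i ∈ s, f i) = ∑ i ∈ s, edgeFun p e (f i) := by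
  induction s using Finset.induction_on with
  | empty => simp [edgeFun_zero]
  | insert a s ha ih => rw [Finset.sum_insert ha, Finset.sum_insert ha, edgeFun_add, ih]

lemma edgeFun_eq_sum (p : V → ℝ × ℝ) {e : Sym2 V} {W : Finset V} (h : ∀ i ∈ e, i ∈ W)
    (v : V → ℝ × ℝ) :
    edgeFun p e v = ∑ k ∈ W, ((v k).1 * edgeFun p e (Pi.single k (1, 0)) +
      (v k).2 * edgeFun p e (Pi.single k (0, 1))) := by
  have key : edgeFun p e v = edgeFun p e (∑ k ∈ W,
      ((v k).1 • (Pi.single k (1, 0) : V → ℝ × ℝ) + (v k).2 • (Pi.single k (0, 1) : V → ℝ × ℝ))) := by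
    refine edgeFun_congr_right p fun i hi => ?_
    rw [Finset.sum_apply, Finset.sum_eq_single i]
    · ext <;> simp
    · intro k _ hk
      simp [hk.symm]
    · intro hi'
      exact absurd (h i hi) hi'
  rw [key, edgeFun_sum]
  simp only [edgeFun_add, edgeFun_smul]

/-- The rigidity matrix of the edges `E`, with columns restricted to the vertices in `W`. -/
def rigidityMatrix (p : V → ℝ × ℝ) (E : Finset (Sym2 V)) (W : Finset V) :
    Matrix E (W ⊕ W) ℝ :=
  fun e => Sum.elim (fun k => edgeFun p e (Pi.single (k : V) (1, 0)))
    (fun k => edgeFun p e (Pi.single (k : V) (0, 1)))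

lemma linearIndepOn_edgeFun_iff (p : V → ℝ × ℝ) {E : Finset (Sym2 V)} {W : Finset V}
    (h : ∀ e ∈ E, ∀ i ∈ e, i ∈ W) :
    LinearIndepOn ℝ (edgeFun p) (E : Set (Sym2 V)) ↔
      LinearIndependent ℝ (rigidityMatrix p E W).row := by
  change LinearIndependent ℝ (fun e : E => edgeFun p e) ↔ _
  rw [Fintype.linearIndependent_iff, Fintype.linearIndependent_iff]
  refine forall_congr' fun g => ?_
  have : ∑ e, g e • edgeFun p e = 0 ↔ ∑ e, g e • (rigidityMatrix p E W).row e = 0 := by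
    constructor
    · intro hg
      ext x
      rcases x with k | k
      · simpa [rigidityMatrix, Finset.sum_apply] using congrFun hg (Pi.single (k : V) (1, 0))
      · simpa [rigidityMatrix, Finset.sum_apply] using congrFun hg (Pi.single (k : V) (0, 1))
    · intro hg
      ext v
      have h1 : ∀ k ∈ W, ∑ e, g e * edgeFun p e (Pi.single k (1, 0)) = 0 := fun k hk => by
        simpa [rigidityMatrix, Finset.sum_apply] using congrFun hg (Sum.inl ⟨k, hk⟩)
      have h2 : ∀ k ∈ W, ∑ e, g e * edgeFun p e (Pi.single k (0, 1)) = 0 := fun k hk => by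
        simpa [rigidityMatrix, Finset.sum_apply] using congrFun hg (Sum.inr ⟨k, hk⟩)
      simp only [Finset.sum_apply, Pi.smul_apply, smul_eq_mul, Pi.zero_apply]
      calc ∑ e, g e * edgeFun p e v
          = ∑ e, ∑ k ∈ W, ((v k).1 * (g e * edgeFun p e (Pi.single k (1, 0))) +
              (v k).2 * (g e * edgeFun p e (Pi.single k (0, 1)))) := by
            refine Finset.sum_congr rfl fun e _ => ?_
            rw [edgeFun_eq_sum p (h e e.2), Finset.mul_sum]
            exact Finset.sum_congr rfl fun k _ => by ring
        _ = 0 := by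
            rw [Finset.sum_comm]
            refine Finset.sum_eq_zero fun k hk => ?_
            rw [Finset.sum_add_distrib, ← Finset.mul_sum, ← Finset.mul_sum, h1 k hk, h2 k hk]
            simp
  rw [this]

lemma linearIndependent_row_iff_rank {m n : Type*} [Fintype m] [Fintype n]
    (A : Matrix m n ℝ) : LinearIndependent ℝ A.row ↔ A.rank = Fintype.card m := by
  rw [A.rank_eq_finrank_span_row, linearIndependent_iff_card_eq_finrank_span, eq_comm]
  rfl

lemma linearIndependent_row_iff_det {m n : Type*} [Fintype m] [DecidableEq m] [Fintype n]
    (A : Matrix m n ℝ) : LinearIndependent ℝ A.row ↔ (A * A.transpose).det ≠ 0 := by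
  rw [linearIndependent_row_iff_rank, ← A.rank_self_mul_transpose,
    ← linearIndependent_row_iff_rank, Matrix.linearIndependent_rows_iff_isUnit,
    Matrix.isUnit_iff_isUnit_det, isUnit_iff_ne_zero]

/-! ### Genericity -/

/-- The coordinates of a realization. -/
def coords (p : V → ℝ × ℝ) : V ⊕ V → ℝ :=
  Sum.elim (fun i => (p i).1) (fun i => (p i).2)

lemma GenericRealization.ne_zero {p : V → ℝ × ℝ} (hp : GenericRealization p)
    {D : (V → ℝ × ℝ) → ℝ}
    (hD : ∃ F : MvPolynomial (V ⊕ V) ℚ, ∀ q, MvPolynomial.aeval (coords q) F = D q)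
    {q : V → ℝ × ℝ} (hq : D q ≠ 0) : D p ≠ 0 := by
  obtain ⟨F, hF⟩ := hD
  intro h
  have hF0 : F = 0 := by
    refine (map_eq_zero_iff (MvPolynomial.aeval (coords p)) hp).1 ?_
    rw [hF, h]
  exact hq (by rw [← hF, hF0, map_zero])

lemma exists_aeval_eq_rigidityMatrix (E : Finset (Sym2 V)) (W : Finset V) (e : E) (x : W ⊕ W) :
    ∃ F : MvPolynomial (V ⊕ V) ℚ, ∀ q,
      MvPolynomial.aeval (coords q) F = rigidityMatrix q E W e x := by
  obtain ⟨e, he⟩ := e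
  induction e using Sym2.ind with
  | _ i j =>
    rcases x with k | k
    · refine ⟨(MvPolynomial.X (Sum.inl i) - MvPolynomial.X (Sum.inl j)) *
        ((if i = k then 1 else 0) - (if j = k then 1 else 0)), fun q => ?_⟩
      by_cases h1 : i = k <;> by_cases h2 : j = k <;>
        simp [rigidityMatrix, edgeFun_mk, coords, dot, Pi.single_apply, h1, h2]
    · refine ⟨(MvPolynomial.X (Sum.inr i) - MvPolynomial.X (Sum.inr j)) *
        ((if i = k then 1 else 0) - (if j = k then 1 else 0)), fun q => ?_⟩
      by_cases h1 : i = k <;> by_cases h2 : j = k <;>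
        simp [rigidityMatrix, edgeFun_mk, coords, dot, Pi.single_apply, h1, h2]

lemma GenericRealization.linearIndepOn {p : V → ℝ × ℝ} (hp : GenericRealization p)
    {q : V → ℝ × ℝ} {E : Finset (Sym2 V)} (hq : LinearIndepOn ℝ (edgeFun q) (E : Set (Sym2 V))) :
    LinearIndepOn ℝ (edgeFun p) (E : Set (Sym2 V)) := by
  have hW : ∀ e ∈ E, ∀ i ∈ e, i ∈ (Finset.univ : Finset V) := fun _ _ _ _ => Finset.mem_univ _
  rw [linearIndepOn_edgeFun_iff _ hW, linearIndependent_row_iff_det] at hq ⊢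
  choose F hF using exists_aeval_eq_rigidityMatrix E (Finset.univ : Finset V)
  refine hp.ne_zero (D := fun q => (rigidityMatrix q E Finset.univ *
    (rigidityMatrix q E Finset.univ).transpose).det)
    ⟨(Matrix.of F * (Matrix.of F).transpose).det, fun q => ?_⟩ hq
  rw [AlgHom.map_det]
  congr 1
  ext a b
  simp [Matrix.mul_apply, hF]

/-- Twice the signed area of the triangle `a b c`. -/
def area (a b c : ℝ × ℝ) : ℝ :=
  (b.1 - a.1) * (c.2 - a.2) - (b.2 - a.2) * (c.1 - a.1)

lemma GenericRealization.area_ne_zero {p : V → ℝ × ℝ} (hp : GenericRealization p) {a b c : V}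
    (hab : a ≠ b) (hac : a ≠ c) (hbc : b ≠ c) : area (p a) (p b) (p c) ≠ 0 := by
  refine hp.ne_zero (D := fun q => area (q a) (q b) (q c))
    ⟨(MvPolynomial.X (Sum.inl b) - MvPolynomial.X (Sum.inl a)) *
      (MvPolynomial.X (Sum.inr c) - MvPolynomial.X (Sum.inr a)) -
      (MvPolynomial.X (Sum.inr b) - MvPolynomial.X (Sum.inr a)) *
      (MvPolynomial.X (Sum.inl c) - MvPolynomial.X (Sum.inl a)), fun q => ?_⟩
    (q := fun i => if i = b then (1, 0) else if i = c then (0, 1) else 0) ?_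
  · simp [area, coords]
  · simp [area, hab, hac, hbc.symm]

lemma GenericRealization.fst_ne {p : V → ℝ × ℝ} (hp : GenericRealization p) {a b : V}
    (hab : a ≠ b) : (p a).1 ≠ (p b).1 := by
  refine sub_ne_zero.1 (hp.ne_zero (D := fun q => (q a).1 - (q b).1)
    ⟨MvPolynomial.X (Sum.inl a) - MvPolynomial.X (Sum.inl b), fun q => ?_⟩
    (q := fun i => if i = a then (1, 0) else 0) ?_)
  · simp [coords]
  · simp [hab.symm]

/-! ### Independence implies sparsity -/

/-- The trivial infinitesimal motions: two translations and a rotation. -/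
def trivialMotions (p : V → ℝ × ℝ) (W : Finset V) : Matrix (W ⊕ W) (Fin 3) ℝ :=
  fun x => Sum.elim (fun k : W => ![1, 0, -(p k).2]) (fun k : W => ![0, 1, (p k).1]) x

lemma rigidityMatrix_mul_trivialMotions (p : V → ℝ × ℝ) {E : Finset (Sym2 V)} {W : Finset V}
    (h : ∀ e ∈ E, ∀ i ∈ e, i ∈ W) : rigidityMatrix p E W * trivialMotions p W = 0 := by
  ext ⟨e, he⟩ t
  have key : ∀ v : V → ℝ × ℝ, edgeFun p e v = 0 →
      (∑ k : W, edgeFun p e (Pi.single (k : V) (1, 0)) * (v k).1) +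
        ∑ k : W, edgeFun p e (Pi.single (k : V) (0, 1)) * (v k).2 = 0 := by
    intro v hv
    rw [edgeFun_eq_sum p (h e he), Finset.sum_add_distrib] at hv
    rw [← Finset.sum_coe_sort W, ← Finset.sum_coe_sort W] at hv
    simpa only [mul_comm] using hv
  rw [Matrix.mul_apply, Fintype.sum_sum_type]
  fin_cases t
  · refine key (fun _ => (1, 0)) ?_
    induction e using Sym2.ind with
    | _ i j => simp [edgeFun_mk, dot]
  · refine key (fun _ => (0, 1)) ?_
    induction e using Sym2.ind with
    | _ i j => simp [edgeFun_mk, dot]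
  · refine key (fun k => (-(p k).2, (p k).1)) ?_
    induction e using Sym2.ind with
    | _ i j =>
      simp only [edgeFun_mk, dot, Prod.fst_sub, Prod.snd_sub]
      ring

lemma rank_trivialMotions (p : V → ℝ × ℝ) {W : Finset V} {a b : V} (ha : a ∈ W) (hb : b ∈ W)
    (hab : (p a).1 ≠ (p b).1) : (trivialMotions p W).rank = 3 := by
  rw [← Matrix.rank_transpose]
  refine ((linearIndependent_row_iff_rank _).1 ?_).trans (Fintype.card_fin 3)
  rw [Fintype.linearIndependent_iff]
  intro g hg
  have h1 := congrFun hg (Sum.inl ⟨a, ha⟩)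
  have h2 := congrFun hg (Sum.inr ⟨a, ha⟩)
  have h3 := congrFun hg (Sum.inr ⟨b, hb⟩)
  simp [Fin.sum_univ_three, trivialMotions] at h1 h2 h3
  have g2 : g 2 = 0 := by
    have : g 2 * ((p a).1 - (p b).1) = 0 := by linarith
    exact (mul_eq_zero.1 this).resolve_right (sub_ne_zero.2 hab)
  intro i
  fin_cases i
  · simpa [g2] using h1
  · simpa [g2] using h2
  · exact g2

lemma card_add_three_le_of_linearIndepOn {p : V → ℝ × ℝ} {E : Finset (Sym2 V)} {W : Finset V}
    (hE : LinearIndepOn ℝ (edgeFun p) (E : Set (Sym2 V))) (h : ∀ e ∈ E, ∀ i ∈ e, i ∈ W)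
    {a b : V} (ha : a ∈ W) (hb : b ∈ W) (hab : (p a).1 ≠ (p b).1) :
    E.card + 3 ≤ 2 * W.card := by
  have h1 := Matrix.rank_add_rank_le_card_of_mul_eq_zero (rigidityMatrix_mul_trivialMotions p h)
  rw [(linearIndependent_row_iff_rank _).1 ((linearIndepOn_edgeFun_iff p h).1 hE),
    rank_trivialMotions p ha hb hab] at h1
  simpa [two_mul] using h1

/-! ### Sparse edge sets -/

/-- The edges of `E` with both endpoints in `X`. -/
def inducedEdges (E : Finset (Sym2 V)) (X : Finset V) : Finset (Sym2 V) :=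
  E.filter fun e => ∀ i ∈ e, i ∈ X

lemma mem_inducedEdges {E : Finset (Sym2 V)} {X : Finset V} {e : Sym2 V} :
    e ∈ inducedEdges E X ↔ e ∈ E ∧ ∀ i ∈ e, i ∈ X := by
  simp [inducedEdges]

/-- A loopless edge set is sparse if any `k ≥ 2` vertices induce at most `2 k - 3` edges. -/
structure IsSparse (E : Finset (Sym2 V)) : Prop where
  not_isDiag : ∀ e ∈ E, ¬ e.IsDiag
  card_le : ∀ X : Finset V, 2 ≤ X.card → (inducedEdges E X).card + 3 ≤ 2 * X.card

/-- A set of `k` vertices is tight if it induces at least `2 k - 3` edges. -/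
def IsTight (E : Finset (Sym2 V)) (X : Finset V) : Prop :=
  2 * X.card ≤ (inducedEdges E X).card + 3

lemma IsSparse.mono {E F : Finset (Sym2 V)} (hF : IsSparse F) (h : E ⊆ F) : IsSparse E :=
  ⟨fun e he => hF.not_isDiag e (h he), fun X hX =>
    (Nat.add_le_add_right (Finset.card_le_card (Finset.filter_subset_filter _ h)) 3).trans
      (hF.card_le X hX)⟩

lemma two_le_card_of_forall_mem {e : Sym2 V} (he : ¬ e.IsDiag) {X : Finset V}
    (h : ∀ i ∈ e, i ∈ X) : 2 ≤ X.card := by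
  rw [← Sym2.card_toFinset_of_not_isDiag e he]
  exact Finset.card_le_card fun i hi => h i (Sym2.mem_toFinset.1 hi)

lemma IsTight.union {E : Finset (Sym2 V)} (hE : IsSparse E) {X Y : Finset V}
    (hX : IsTight E X) (hY : IsTight E Y) (h : 2 ≤ (X ∩ Y).card) : IsTight E (X ∪ Y) := by
  have h1 := hE.card_le _ h
  have h2 := Finset.card_union_add_card_inter X Y
  have h3 := Finset.card_union_add_card_inter (inducedEdges E X) (inducedEdges E Y)
  have h4 : (inducedEdges E X ∪ inducedEdges E Y).card ≤ (inducedEdges E (X ∪ Y)).card := by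
    refine Finset.card_le_card fun e he => ?_
    simp only [Finset.mem_union, mem_inducedEdges] at he ⊢
    grind
  have h5 : (inducedEdges E X ∩ inducedEdges E Y).card ≤ (inducedEdges E (X ∩ Y)).card := by
    refine Finset.card_le_card fun e he => ?_
    simp only [Finset.mem_inter, mem_inducedEdges] at he ⊢
    grind
  unfold IsTight at *
  omega

lemma disjoint_inducedEdges {E : Finset (Sym2 V)} (hE : ∀ e ∈ E, ¬ e.IsDiag) {X Y : Finset V}
    (h : (X ∩ Y).card ≤ 1) : Disjoint (inducedEdges E X) (inducedEdges E Y) := by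
  rw [Finset.disjoint_left]
  intro e h1 h2
  rw [mem_inducedEdges] at h1 h2
  have := two_le_card_of_forall_mem (hE e h1.1)
    fun i hi => Finset.mem_inter.2 ⟨h1.2 i hi, h2.2 i hi⟩
  omega

lemma IsTight.union_union {E : Finset (Sym2 V)} (hE : ∀ e ∈ E, ¬ e.IsDiag) {X Y Z : Finset V}
    (hX : IsTight E X) (hY : IsTight E Y) (hZ : IsTight E Z) (hXY : (X ∩ Y).card = 1)
    (hXZ : (X ∩ Z).card ≤ 1) (hYZ : (Y ∩ Z).card ≤ 1) (h : 2 ≤ ((X ∪ Y) ∩ Z).card) :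
    IsTight E (X ∪ Y ∪ Z) := by
  have h1 := Finset.card_union_add_card_inter X Y
  have h2 := Finset.card_union_add_card_inter (X ∪ Y) Z
  have h3 := Finset.card_union_of_disjoint (disjoint_inducedEdges hE hXY.le)
  have h4 : Disjoint (inducedEdges E X ∪ inducedEdges E Y) (inducedEdges E Z) :=
    Finset.disjoint_union_left.2 ⟨disjoint_inducedEdges hE hXZ, disjoint_inducedEdges hE hYZ⟩
  have h5 := Finset.card_union_of_disjoint h4
  have h6 : (inducedEdges E X ∪ inducedEdges E Y ∪ inducedEdges E Z).card ≤
      (inducedEdges E (X ∪ Y ∪ Z)).card := by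
    refine Finset.card_le_card fun e he => ?_
    simp only [Finset.mem_union, mem_inducedEdges] at he ⊢
    grind
  unfold IsTight at *
  omega

/-- If no tight set contains both `a` and `b`, then the edge `ab` is new and can be added. -/
lemma IsSparse.insert_edge {E : Finset (Sym2 V)} (hE : IsSparse E) {a b : V} (hab : a ≠ b)
    (h : ∀ X, a ∈ X → b ∈ X → ¬ IsTight E X) :
    s(a, b) ∉ E ∧ IsSparse (insert s(a, b) E) := by
  refine ⟨fun hmem => ?_, ?_, fun X hX => ?_⟩
  · refine h {a, b} (by simp) (by simp) ?_
    have : 0 < (inducedEdges E {a, b}).card :=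
      Finset.card_pos.2 ⟨s(a, b), mem_inducedEdges.2 ⟨hmem, by simp⟩⟩
    rw [IsTight, Finset.card_pair hab]
    omega
  · simpa [hab] using hE.not_isDiag
  · have h1 := hE.card_le X hX
    by_cases hmem : a ∈ X ∧ b ∈ X
    · have h2 := h X hmem.1 hmem.2
      have h3 : (inducedEdges (insert s(a, b) E) X).card ≤ (inducedEdges E X).card + 1 := by
        refine (Finset.card_le_card fun e he => ?_).trans
          (Finset.card_insert_le s(a, b) (inducedEdges E X))
        simp only [Finset.mem_insert, mem_inducedEdges] at he ⊢
        tauto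
      unfold IsTight at h2
      omega
    · have : inducedEdges (insert s(a, b) E) X = inducedEdges E X := by
        rw [inducedEdges, Finset.filter_insert, if_neg (by simpa using hmem), inducedEdges]
      rwa [this]

/-- The combinatorial part of undoing a 1-extension: if `v` has degree three, with neighbours
`a`, `b` and `c`, then some edge between its neighbours can replace the edges at `v`. -/
lemma IsSparse.false_of_isTight {E : Finset (Sym2 V)} {v a b c : V}
    (hv : ∀ e ∈ E, v ∉ e) (hab : a ≠ b) (hac : a ≠ c) (hbc : b ≠ c)
    (hE : IsSparse (insert s(v, a) (insert s(v, b) (insert s(v, c) E)))) {X Y Z : Finset V}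
    (hX : IsTight E X) (hY : IsTight E Y) (hZ : IsTight E Z) (hXa : a ∈ X) (hXb : b ∈ X)
    (hYb : b ∈ Y) (hYc : c ∈ Y) (hZa : a ∈ Z) (hZc : c ∈ Z) : False := by
  have key : ∀ T, a ∈ T → b ∈ T → c ∈ T → ¬ IsTight E T := by
    intro T ha hb hc hT
    have h1 := hE.card_le (insert v T) <|
      le_trans (Finset.one_lt_card.2 ⟨a, ha, b, hb, hab⟩ : 2 ≤ T.card)
        (Finset.card_le_card (Finset.subset_insert _ _))
    have h2 : insert s(v, a) (insert s(v, b) (insert s(v, c) (inducedEdges E T))) ⊆ inducedEdges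
        (insert s(v, a) (insert s(v, b) (insert s(v, c) E))) (insert v T) := by
      intro e he
      simp only [Finset.mem_insert, mem_inducedEdges] at he ⊢
      rcases he with rfl | rfl | rfl | he
      · simp [ha]
      · simp [hb]
      · simp [hc]
      · exact ⟨by tauto, fun i hi => Or.inr (he.2 i hi)⟩
    have hn : ∀ u, s(v, u) ∉ inducedEdges E T := fun u hu =>
      hv _ (mem_inducedEdges.1 hu).1 (Sym2.mem_mk_left v u)
    have h3 := Finset.card_le_card h2
    rw [Finset.card_insert_of_notMem (by
        simp only [Finset.mem_insert, Sym2.congr_right, hab, hac, hn, or_self, not_false_eq_true]),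
      Finset.card_insert_of_notMem (by
        simp only [Finset.mem_insert, Sym2.congr_right, hbc, hn, or_self, not_false_eq_true]),
      Finset.card_insert_of_notMem (hn c)] at h3
    have h4 := Finset.card_insert_le v T
    unfold IsTight at hT
    omega
  have hE' : IsSparse E := hE.mono fun e he => by simp [he]
  have hXY : ¬ 2 ≤ (X ∩ Y).card := fun h => key _ (by simp [hXa]) (by simp [hXb]) (by simp [hYc])
    (hX.union hE' hY h)
  have hXZ : ¬ 2 ≤ (X ∩ Z).card := fun h => key _ (by simp [hXa]) (by simp [hXb]) (by simp [hZc])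
    (hX.union hE' hZ h)
  have hYZ : ¬ 2 ≤ (Y ∩ Z).card := fun h => key _ (by simp [hZa]) (by simp [hYb]) (by simp [hZc])
    (hY.union hE' hZ h)
  have hpos : 0 < (X ∩ Y).card := Finset.card_pos.2 ⟨b, by simp [hXb, hYb]⟩
  refine key (X ∪ Y ∪ Z) (by simp [hXa]) (by simp [hXb]) (by simp [hYc])
    (hX.union_union hE'.not_isDiag hY hZ (by omega) (by omega) (by omega) ?_)
  exact Finset.one_lt_card.2 ⟨a, by simp [hXa, hZa], c, by simp [hYc, hZc], hac⟩

lemma sym2Mk_right_injective (v : V) : Function.Injective fun u => s(v, u) :=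
  fun _ _ => Sym2.congr_right.1

lemma IsSparse.exists_degree_le_three {E : Finset (Sym2 V)} (hE : IsSparse E)
    (hne : E.Nonempty) :
    ∃ v, 1 ≤ (Finset.univ.filter fun u => s(v, u) ∈ E).card ∧
      (Finset.univ.filter fun u => s(v, u) ∈ E).card ≤ 3 := by
  have hdeg : ∀ v, (E.filter fun e => v ∈ e).card =
      (Finset.univ.filter fun u => s(v, u) ∈ E).card := fun v => by
    rw [← Finset.card_image_of_injective (Finset.univ.filter fun u => s(v, u) ∈ E)
      (sym2Mk_right_injective v)]
    congr 1
    ext e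
    simp only [Finset.mem_filter, Finset.mem_image, Finset.mem_univ, true_and]
    constructor
    · rintro ⟨he, u, rfl⟩
      exact ⟨u, he, rfl⟩
    · rintro ⟨u, hu, rfl⟩
      exact ⟨hu, Sym2.mem_mk_left v u⟩
  simp only [← hdeg]
  by_contra! hcon
  have hspan : ∀ e ∈ E, ∀ i ∈ e, i ∈ spannedVerts E := fun e he i hi => by
    simp only [spannedVerts, Finset.mem_filter, Finset.mem_univ, true_and]
    exact ⟨e, he, hi⟩
  have h1 : ∑ v ∈ spannedVerts E, 4 ≤ ∑ v ∈ spannedVerts E, (E.filter fun e => v ∈ e).card := by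
    refine Finset.sum_le_sum fun v hv => hcon v (Finset.card_pos.2 ?_)
    simp only [spannedVerts, Finset.mem_filter, Finset.mem_univ, true_and] at hv
    obtain ⟨e, he, hve⟩ := hv
    exact ⟨e, by simp [he, hve]⟩
  have h2 : ∑ v ∈ spannedVerts E, (E.filter fun e => v ∈ e).card = ∑ e ∈ E, 2 := by
    refine (Finset.sum_card_bipartiteAbove_eq_sum_card_bipartiteBelow
      (fun (v : V) (e : Sym2 V) => v ∈ e)).trans (Finset.sum_congr rfl fun e he => ?_)
    rw [← Sym2.card_toFinset_of_not_isDiag e (hE.not_isDiag e he)]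
    congr 1
    ext i
    simp only [Finset.bipartiteBelow, Finset.mem_filter, Sym2.mem_toFinset]
    exact ⟨fun h => h.2, fun h => ⟨hspan e he i h, h⟩⟩
  obtain ⟨e, he⟩ := hne
  have h3 := hE.card_le (spannedVerts E)
    (two_le_card_of_forall_mem (hE.not_isDiag e he) (hspan e he))
  have h4 : inducedEdges E (spannedVerts E) = E := Finset.filter_true_of_mem hspan
  rw [h4] at h3
  simp only [Finset.sum_const, smul_eq_mul] at h1 h2
  omega

/-! ### Extensions -/

/-- Testing a linear relation on velocities supported at the vertex `v`. -/
lemma sum_smul_eq_zero_of_relation (q : V → ℝ × ℝ) {E : Finset (Sym2 V)} {v : V}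
    (hv : ∀ e ∈ E, v ∉ e) {N : Finset V} (hN : v ∉ N) (f : Sym2 V → ℝ)
    (h : ∑ u ∈ N, f s(v, u) • edgeFun q s(v, u) + ∑ e ∈ E, f e • edgeFun q e = 0) :
    ∑ u ∈ N, f s(v, u) • (q v - q u) = 0 := by
  have key : ∀ w, ∑ u ∈ N, f s(v, u) * dot (q v - q u) w = 0 := fun w => by
    have h1 := congrFun h (Pi.single v w)
    simp only [Pi.add_apply, Finset.sum_apply, Pi.smul_apply, smul_eq_mul, Pi.zero_apply] at h1
    rw [Finset.sum_eq_zero (s := E) fun e he => by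
      rw [edgeFun_single_of_notMem q (hv e he), mul_zero], add_zero] at h1
    rw [← h1]
    refine Finset.sum_congr rfl fun u hu => ?_
    rw [edgeFun_single q (ne_of_mem_of_not_mem hu hN)]
  ext
  · simpa [dot, Prod.fst_sum] using key (1, 0)
  · simpa [dot, Prod.snd_sum] using key (0, 1)

/-- Adding a vertex `v` whose edge directions are linearly independent preserves independence. -/
lemma linearIndepOn_zero_extension {q : V → ℝ × ℝ} {E : Finset (Sym2 V)} {v : V}
    (hE : LinearIndepOn ℝ (edgeFun q) (E : Set (Sym2 V))) (hv : ∀ e ∈ E, v ∉ e)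
    {N : Finset V} (hN : v ∉ N) (hq : LinearIndepOn ℝ (fun u => q v - q u) (N : Set V)) :
    LinearIndepOn ℝ (edgeFun q) (↑(N.image (fun u => s(v, u)) ∪ E) : Set (Sym2 V)) := by
  rw [linearIndepOn_finset_iff] at hE hq ⊢
  intro f hf
  have hdisj : Disjoint (N.image fun u => s(v, u)) E := by
    rw [Finset.disjoint_left]
    intro e he he'
    obtain ⟨u, -, rfl⟩ := Finset.mem_image.1 he
    exact hv _ he' (Sym2.mem_mk_left v u)
  rw [Finset.sum_union hdisj, Finset.sum_image (sym2Mk_right_injective v).injOn] at hf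
  have h1 := hq (fun u => f s(v, u)) (sum_smul_eq_zero_of_relation q hv hN f hf)
  rw [Finset.sum_eq_zero fun u hu => by rw [h1 u hu, zero_smul], zero_add] at hf
  have h2 := hE f hf
  intro e he
  rcases Finset.mem_union.1 he with he | he
  · obtain ⟨u, hu, rfl⟩ := Finset.mem_image.1 he
    exact h1 u hu
  · exact h2 e he

lemma linearIndepOn_one_extension {q : V → ℝ × ℝ} {E : Finset (Sym2 V)} {v a b c : V}
    (hab : s(a, b) ∉ E) (hv : ∀ e ∈ E, v ∉ e)
    (hE : LinearIndepOn ℝ (edgeFun q) (↑(insert s(a, b) E) : Set (Sym2 V)))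
    (hva : v ≠ a) (hvb : v ≠ b) (hvc : v ≠ c) (hne_ab : a ≠ b) (hac : a ≠ c) (hbc : b ≠ c)
    (hmid : q v = (1 / 2 : ℝ) • (q a + q b)) (harea : area (q a) (q b) (q c) ≠ 0) :
    LinearIndepOn ℝ (edgeFun q)
      (↑(({a, b, c} : Finset V).image (fun u => s(v, u)) ∪ E) : Set (Sym2 V)) := by
  rw [linearIndepOn_finset_iff] at hE ⊢
  intro f hf
  have hdisj : Disjoint (({a, b, c} : Finset V).image fun u => s(v, u)) E := by
    rw [Finset.disjoint_left]
    intro e he he'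
    obtain ⟨u, -, rfl⟩ := Finset.mem_image.1 he
    exact hv _ he' (Sym2.mem_mk_left v u)
  rw [Finset.sum_union hdisj, Finset.sum_image (sym2Mk_right_injective v).injOn] at hf
  have h1 := sum_smul_eq_zero_of_relation q hv (by simp [hva, hvb, hvc]) f hf
  rw [Finset.sum_insert (by simp [hne_ab, hac]), Finset.sum_insert (by simp [hbc]),
    Finset.sum_singleton] at h1 hf
  have hx := congrArg Prod.fst h1
  have hy := congrArg Prod.snd h1
  simp only [hmid, Prod.fst_add, Prod.snd_add, Prod.smul_fst, Prod.smul_snd, Prod.fst_sub,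
    Prod.snd_sub, smul_eq_mul, Prod.fst_zero, Prod.snd_zero] at hx hy
  have hc : f s(v, c) = 0 := by
    have : f s(v, c) * area (q a) (q b) (q c) = 0 := by
      unfold area
      linear_combination ((q b).2 - (q a).2) * hx - ((q b).1 - (q a).1) * hy
    exact (mul_eq_zero.1 this).resolve_right harea
  have heq : f s(v, a) = f s(v, b) := by
    rw [hc] at hx hy
    by_contra hne
    have hx' : (q b).1 - (q a).1 = 0 := by
      refine (mul_eq_zero.1 ?_).resolve_left (sub_ne_zero.2 hne)
      linear_combination 2 * hx
    have hy' : (q b).2 - (q a).2 = 0 := by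
      refine (mul_eq_zero.1 ?_).resolve_left (sub_ne_zero.2 hne)
      linear_combination 2 * hy
    exact harea (by simp [area, hx', hy'])
  have hsum : edgeFun q s(v, a) + edgeFun q s(v, b) = (1 / 2 : ℝ) • edgeFun q s(a, b) := by
    funext w
    simp only [Pi.add_apply, Pi.smul_apply, smul_eq_mul, edgeFun_mk, dot, hmid, Prod.fst_add,
      Prod.snd_add, Prod.smul_fst, Prod.smul_snd, Prod.fst_sub, Prod.snd_sub]
    ring
  have h2 := hE (Function.update f s(a, b) (f s(v, b) / 2)) (by
    rw [Finset.sum_insert hab, Function.update_self, ← hf, hc, heq, zero_smul, add_zero,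
      ← smul_add, hsum, smul_smul, div_eq_mul_one_div]
    congr 1
    refine Finset.sum_congr rfl fun e he => ?_
    rw [Function.update_of_ne (ne_of_mem_of_not_mem he hab)])
  have hb : f s(v, b) = 0 := by
    have := h2 _ (Finset.mem_insert_self _ _)
    rw [Function.update_self] at this
    linarith
  intro e he
  simp only [Finset.mem_union, Finset.mem_image, Finset.mem_insert, Finset.mem_singleton] at he
  rcases he with ⟨u, rfl | rfl | rfl, rfl⟩ | he
  · exact heq.trans hb
  · exact hb
  · exact hc
  · have := h2 e (Finset.mem_insert_of_mem he)
    rwa [Function.update_of_ne (ne_of_mem_of_not_mem he hab)] at this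

lemma GenericRealization.one_extension {p : V → ℝ × ℝ} (hp : GenericRealization p)
    {E : Finset (Sym2 V)} {v a b c : V} (hab : s(a, b) ∉ E) (hv : ∀ e ∈ E, v ∉ e)
    (hE : LinearIndepOn ℝ (edgeFun p) (↑(insert s(a, b) E) : Set (Sym2 V)))
    (hva : v ≠ a) (hvb : v ≠ b) (hvc : v ≠ c) (hne_ab : a ≠ b) (hac : a ≠ c) (hbc : b ≠ c) :
    LinearIndepOn ℝ (edgeFun p)
      (↑(({a, b, c} : Finset V).image (fun u => s(v, u)) ∪ E) : Set (Sym2 V)) := by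
  set q := Function.update p v ((1 / 2 : ℝ) • (p a + p b)) with hq
  have hqu : ∀ u, v ≠ u → q u = p u := fun u hu => Function.update_of_ne hu.symm _ _
  refine hp.linearIndepOn (q := q) (linearIndepOn_one_extension hab hv ?_ hva hvb hvc hne_ab hac
    hbc ?_ ?_)
  · refine (linearIndepOn_congr fun e he => edgeFun_congr_left fun i hi => ?_).1 hE
    refine (hqu i fun hvi => ?_).symm
    subst hvi
    rcases Finset.mem_insert.1 (Finset.mem_coe.1 he) with rfl | he
    · rcases Sym2.mem_iff.1 hi with h | h
      exacts [hva h, hvb h]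
    · exact hv e he hi
  · rw [hqu a hva, hqu b hvb, hq, Function.update_self]
  · rw [hqu a hva, hqu b hvb, hqu c hvc]
    exact hp.area_ne_zero hne_ab hac hbc

/-! ### Sparsity implies independence -/

lemma IsSparse.linearIndepOn {p : V → ℝ × ℝ} (hp : GenericRealization p)
    {E : Finset (Sym2 V)} (hE : IsSparse E) :
    LinearIndepOn ℝ (edgeFun p) (E : Set (Sym2 V)) := by
  induction hn : E.card using Nat.strong_induction_on generalizing E with
  | _ n ih =>
  subst hn
  rcases E.eq_empty_or_nonempty with rfl | hne
  · simp
  obtain ⟨v, hpos, hle⟩ := hE.exists_degree_le_three hne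
  obtain ⟨N, hN⟩ : ∃ N, N = Finset.univ.filter fun u => s(v, u) ∈ E := ⟨_, rfl⟩
  obtain ⟨F, hF⟩ : ∃ F, F = E.filter fun e => v ∉ e := ⟨_, rfl⟩
  rw [← hN] at hpos hle
  have hvN : v ∉ N := by
    simpa [hN] using fun h => hE.not_isDiag _ h (Sym2.mk_isDiag_iff.2 rfl)
  have hvF : ∀ e ∈ F, v ∉ e := fun e he => by
    rw [hF] at he
    exact (Finset.mem_filter.1 he).2
  have hEeq : E = N.image (fun u => s(v, u)) ∪ F := by
    ext e
    simp only [hN, hF, Finset.mem_union, Finset.mem_image, Finset.mem_filter, Finset.mem_univ,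
      true_and]
    constructor
    · intro he
      by_cases hve : v ∈ e
      · obtain ⟨u, rfl⟩ := hve
        exact Or.inl ⟨u, he, rfl⟩
      · exact Or.inr ⟨he, hve⟩
    · rintro (⟨u, hu, rfl⟩ | h)
      exacts [hu, h.1]
  have hcard : E.card = N.card + F.card := by
    rw [hEeq, Finset.card_union_of_disjoint,
      Finset.card_image_of_injective _ (sym2Mk_right_injective v)]
    · rw [Finset.disjoint_left]
      intro e he he'
      obtain ⟨u, -, rfl⟩ := Finset.mem_image.1 he
      exact hvF _ he' (Sym2.mem_mk_left v u)
  have hFE : F ⊆ E := hF ▸ Finset.filter_subset _ _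
  clear hN hF
  have hFind := ih F.card (by omega) (hE.mono hFE) rfl
  obtain h1 | h2 | h3 : N.card = 1 ∨ N.card = 2 ∨ N.card = 3 := by omega
  · rw [hEeq]
    refine linearIndepOn_zero_extension hFind hvF hvN ?_
    obtain ⟨a, rfl⟩ := Finset.card_eq_one.1 h1
    rw [linearIndepOn_finset_iff]
    intro g hg u hu
    rw [Finset.sum_singleton] at hg
    rw [Finset.mem_singleton.1 hu]
    refine (mul_eq_zero.1 (congrArg Prod.fst hg)).resolve_right (sub_ne_zero.2 (hp.fst_ne ?_))
    simpa using hvN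
  · rw [hEeq]
    refine linearIndepOn_zero_extension hFind hvF hvN ?_
    obtain ⟨a, b, hab, rfl⟩ := Finset.card_eq_two.1 h2
    simp only [Finset.mem_insert, Finset.mem_singleton, not_or] at hvN
    have harea := hp.area_ne_zero hvN.1 hvN.2 hab
    rw [linearIndepOn_finset_iff]
    intro g hg u hu
    rw [Finset.sum_pair hab] at hg
    have hx := congrArg Prod.fst hg
    have hy := congrArg Prod.snd hg
    simp only [Prod.fst_add, Prod.snd_add, Prod.smul_fst, Prod.smul_snd, Prod.fst_sub,
      Prod.snd_sub, smul_eq_mul, Prod.fst_zero, Prod.snd_zero] at hx hy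
    unfold area at harea
    rw [Finset.mem_insert, Finset.mem_singleton] at hu
    rcases hu with rfl | rfl
    · refine (mul_eq_zero.1 ?_).resolve_right harea
      linear_combination ((p v).2 - (p b).2) * hx - ((p v).1 - (p b).1) * hy
    · refine (mul_eq_zero.1 ?_).resolve_right harea
      linear_combination ((p v).1 - (p a).1) * hy - ((p v).2 - (p a).2) * hx
  · have key : ∀ a b c, N = {a, b, c} → a ≠ b → a ≠ c → b ≠ c →
        (∀ X, a ∈ X → b ∈ X → ¬ IsTight F X) →
        LinearIndepOn ℝ (edgeFun p) (E : Set (Sym2 V)) := by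
      rintro a b c rfl hab hac hbc hX
      obtain ⟨hmem, hsp⟩ := (hE.mono hFE).insert_edge hab hX
      simp only [Finset.mem_insert, Finset.mem_singleton, not_or] at hvN
      rw [hEeq]
      refine hp.one_extension hmem hvF (ih _ ?_ hsp rfl) hvN.1 hvN.2.1 hvN.2.2 hab hac hbc
      have := Finset.card_insert_le s(a, b) F
      omega
    obtain ⟨a, b, c, hab, hac, hbc, hN⟩ := Finset.card_eq_three.1 h3
    by_contra hcon
    have hX : ∃ X, a ∈ X ∧ b ∈ X ∧ IsTight F X := by
      by_contra! h
      exact hcon (key a b c hN hab hac hbc h)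
    have hY : ∃ X, b ∈ X ∧ c ∈ X ∧ IsTight F X := by
      by_contra! h
      exact hcon (key b c a (by rw [hN]; ext; simp; tauto) hbc hab.symm hac.symm h)
    have hZ : ∃ X, a ∈ X ∧ c ∈ X ∧ IsTight F X := by
      by_contra! h
      exact hcon (key a c b (by rw [hN]; ext; simp; tauto) hac hab hbc.symm h)
    obtain ⟨X, hXa, hXb, hX⟩ := hX
    obtain ⟨Y, hYb, hYc, hY⟩ := hY
    obtain ⟨Z, hZa, hZc, hZ⟩ := hZ
    refine IsSparse.false_of_isTight hvF hab hac hbc ?_ hX hY hZ hXa hXb hYb hYc hZa hZc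
    rw [hEeq, hN] at hE
    refine hE.mono (le_of_eq ?_)
    simp [Finset.image_insert, Finset.insert_union]

/-- **Laman's theorem.** For a bar-joint framework `(G, p)` in the plane with generic
realization `p`, the edges of `G` are independent (the rigidity functionals of all
edges are linearly independent) if and only if every nonempty subset `E'` of the edges
satisfies `|E'| ≤ 2 n' − 3`, where `n'` is the number of vertices incident to some
edge of `E'`. -/
theorem laman_theorem (G : SimpleGraph V) (p : V → ℝ × ℝ)
    (hp : GenericRealization p) :
    LinearIndependent ℝ (fun e : G.edgeSet => edgeFun p (e : Sym2 V)) ↔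
      ∀ E' : Finset (Sym2 V), E'.Nonempty → ↑E' ⊆ G.edgeSet →
        (E'.card : ℤ) ≤ 2 * (spannedVerts E').card - 3 := by
  have hnd : ∀ e ∈ G.edgeSet, ¬ e.IsDiag := fun e he => G.not_isDiag_of_mem_edgeSet he
  constructor
  · intro h E' hne hsub
    have hspan : ∀ e ∈ E', ∀ i ∈ e, i ∈ spannedVerts E' := fun e he i hi => by
      simp only [spannedVerts, Finset.mem_filter, Finset.mem_univ, true_and]
      exact ⟨e, he, hi⟩
    have hE' : LinearIndepOn ℝ (edgeFun p) (E' : Set (Sym2 V)) :=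
      LinearIndepOn.mono (s := G.edgeSet) h hsub
    obtain ⟨e, he⟩ := hne
    induction e using Sym2.ind with
    | _ a b =>
      have hab : a ≠ b := fun hab => hnd _ (hsub he) (Sym2.mk_isDiag_iff.2 hab)
      have := card_add_three_le_of_linearIndepOn hE' hspan (hspan _ he a (Sym2.mem_mk_left a b))
        (hspan _ he b (Sym2.mem_mk_right a b)) (hp.fst_ne hab)
      omega
  · intro h
    have hfin := G.edgeSet.toFinite
    have hsp : IsSparse hfin.toFinset := by
      refine ⟨fun e he => hnd e (hfin.mem_toFinset.1 he), fun X hX => ?_⟩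
      rcases (inducedEdges hfin.toFinset X).eq_empty_or_nonempty with h0 | h0
      · rw [h0, Finset.card_empty]
        omega
      · have h1 := h _ h0 fun e he => hfin.mem_toFinset.1 (mem_inducedEdges.1 he).1
        have h2 : (spannedVerts (inducedEdges hfin.toFinset X)).card ≤ X.card := by
          refine Finset.card_le_card fun i hi => ?_
          simp only [spannedVerts, Finset.mem_filter, Finset.mem_univ, true_and] at hi
          obtain ⟨e, he, hie⟩ := hi
          exact (mem_inducedEdges.1 he).2 i hie
        omega
    have := hsp.linearIndepOn hp
    rw [hfin.coe_toFinset] at this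
    exact this
end
end

section
/- Let a two-dimensional body-bar framework with n bodies and m point-like bodies have exactly K(n,m) = 3n + 2m − 3 bars and be rigid, and suppose every two point-like bodies have distinct positions. Then for every nonempty subset E' of its bars, |E'| ≤ 3n' + 2m' − 3, where n' and m' are the numbers of bodies and point-like bodies incident to some bar of E'. -/
open scoped Classical

set_option linter.unusedSectionVars false

noncomputable section

/-- Planar cross product `x ∧ y = x₁ y₂ − x₂ y₁`. -/
def cross (x y : ℝ × ℝ) : ℝ := x.1 * y.2 - x.2 * y.1

/-- Rotation by 90 degrees: `J x = (−x₂, x₁)`. -/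
def Jrot (x : ℝ × ℝ) : ℝ × ℝ := (-x.2, x.1)

/-- A two-dimensional body-bar framework: `Vn` is the set of (non-trivial) bodies,
`Vm` the set of point-like bodies (with positions `pos`), and `E` the set of bars.
Each bar `e` joins the two distinct nodes `endA e` and `endB e` and carries joint
positions `jA e` and `jB e` at its two ends; the joint position at a point-like body
is that body's position. -/
structure BodyBar (Vn Vm E : Type*) where
  pos : Vm → ℝ × ℝ
  endA : E → Vn ⊕ Vm
  endB : E → Vn ⊕ Vm
  ends_ne : ∀ e, endA e ≠ endB e
  jA : E → ℝ × ℝ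
  jB : E → ℝ × ℝ
  jA_pt : ∀ e a, endA e = Sum.inr a → jA e = pos a
  jB_pt : ∀ e a, endB e = Sum.inr a → jB e = pos a

/-- The velocity space: each body gets a velocity in `ℝ²` and an angular velocity in
`ℝ`; each point-like body gets just a velocity in `ℝ²`. -/
abbrev Vel (Vn Vm : Type*) := ((Vn ⊕ Vm) → ℝ × ℝ) × (Vn → ℝ)

/-- The angular velocity of a node (zero for point-like bodies). -/
def angVel {Vn Vm : Type*} (W : Vel Vn Vm) : Vn ⊕ Vm → ℝ := Sum.elim W.2 (fun _ => 0)

variable {Vn Vm E : Type*}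

/-- The bar functional
`R_e(W) = (x_e − y_e)·(v_a − v_b) + (y_e ∧ x_e)(ω_a − ω_b)` of a bar `e` from `a` to `b`. -/
def barFun (F : BodyBar Vn Vm E) (e : E) : Vel Vn Vm → ℝ := fun W =>
  dot (F.jA e - F.jB e) (W.1 (F.endA e) - W.1 (F.endB e)) +
    cross (F.jB e) (F.jA e) * (angVel W (F.endA e) - angVel W (F.endB e))

/-- The rank of the family of bar functionals. -/
def barRank (F : BodyBar Vn Vm E) : ℕ :=
  Module.finrank ℝ (Submodule.span ℝ (Set.range (barFun F)))

/-- A body-bar framework is rigid if the rank of the family of bar functionals equals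
`K(n,m) = 3n + 2m − 3`. -/
def IsRigid [Fintype Vn] [Fintype Vm] (F : BodyBar Vn Vm E) : Prop :=
  (barRank F : ℤ) = 3 * Fintype.card Vn + 2 * Fintype.card Vm - 3

/-- A bar is dependent if its functional lies in the span of the functionals of the
other bars. -/
def DependentBar (F : BodyBar Vn Vm E) (e : E) : Prop :=
  barFun F e ∈ Submodule.span ℝ (barFun F '' {f | f ≠ e})

/-- The set of bodies incident to some edge of `S` (for given end maps). -/
def incN [Fintype Vn] {ε : Type*} (eA eB : ε → Vn ⊕ Vm) (S : Finset ε) : Finset Vn :=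
  Finset.univ.filter (fun a => ∃ e ∈ S, eA e = Sum.inl a ∨ eB e = Sum.inl a)

/-- The set of point-like bodies incident to some edge of `S` (for given end maps). -/
def incM [Fintype Vm] {ε : Type*} (eA eB : ε → Vn ⊕ Vm) (S : Finset ε) : Finset Vm :=
  Finset.univ.filter (fun a => ∃ e ∈ S, eA e = Sum.inr a ∨ eB e = Sum.inr a)

/-- The set of all coordinates of point-like body bodies' positions and of surface-joint
positions on (non-trivial) bodies. -/
def coordSet (F : BodyBar Vn Vm E) : Set ℝ :=
  {r | (∃ a : Vm, r = (F.pos a).1 ∨ r = (F.pos a).2) ∨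
       (∃ e : E, ((F.endA e).isLeft ∧ (r = (F.jA e).1 ∨ r = (F.jA e).2)) ∨
                 ((F.endB e).isLeft ∧ (r = (F.jB e).1 ∨ r = (F.jB e).2)))}

/-- A body-bar framework is generic if the collection of all coordinates of the
point-like body positions and of the (distinct) surface-joint positions on bodies is
algebraically independent over `ℚ`, and no surface joint of a body is an endpoint of
more than two bars. -/
def GenericBB [Fintype E] (F : BodyBar Vn Vm E) : Prop :=
  AlgebraicIndependent ℚ (fun r : coordSet F => (r : ℝ)) ∧
  ∀ (a : Vn) (q : ℝ × ℝ),
    (Finset.univ.filter (fun e : E => F.endA e = Sum.inl a ∧ F.jA e = q)).card +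
      (Finset.univ.filter (fun e : E => F.endB e = Sum.inl a ∧ F.jB e = q)).card ≤ 2

/-- The bar functional as a linear form. -/
def barLin (F : BodyBar Vn Vm E) (e : E) : Vel Vn Vm →ₗ[ℝ] ℝ where
  toFun := barFun F e
  map_add' W W' := by
    rcases hA : F.endA e with a | a <;> rcases hB : F.endB e with b | b <;>
      simp [barFun, dot, angVel, hA, hB] <;> ring
  map_smul' c W := by
    rcases hA : F.endA e with a | a <;> rcases hB : F.endB e with b | b <;>
      simp [barFun, dot, angVel, hA, hB] <;> ring

/-- The trivial motions: a translation velocity together with an angular velocity about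
the origin. -/
def trivialMotion (F : BodyBar Vn Vm E) : ((ℝ × ℝ) × ℝ) →ₗ[ℝ] Vel Vn Vm where
  toFun t := (Sum.elim (fun _ => t.1) (fun a => t.1 + t.2 • Jrot (F.pos a)), fun _ => t.2)
  map_add' s t := by
    refine Prod.ext (funext fun a => ?_) (funext fun a => rfl)
    rcases a with a | a <;> ext <;> simp [Jrot] <;> ring
  map_smul' c t := by
    refine Prod.ext (funext fun a => ?_) (funext fun a => rfl)
    rcases a with a | a <;> ext <;> simp [Jrot] <;> ring

lemma barLin_trivialMotion (F : BodyBar Vn Vm E) (e : E) (t : (ℝ × ℝ) × ℝ) :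
    barLin F e (trivialMotion F t) = 0 := by
  change barFun F e (trivialMotion F t) = 0
  rcases hA : F.endA e with a | a <;> rcases hB : F.endB e with b | b <;>
    simp [barFun, trivialMotion, dot, cross, Jrot, angVel, hA, hB]
  · rw [F.jB_pt e b hB]; ring
  · rw [F.jA_pt e a hA]; ring
  · rw [F.jA_pt e a hA, F.jB_pt e b hB]; ring

/-- Trivial motions are faithful on a framework having a bar. -/
lemma trivialMotion_injective [Nonempty E] (F : BodyBar Vn Vm E)
    (hinj : Function.Injective F.pos) : Function.Injective (trivialMotion F) := by
  rw [← LinearMap.ker_eq_bot, LinearMap.ker_eq_bot']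
  rintro t ht
  have h1 : ∀ a, (trivialMotion F t).1 a = 0 := fun a => by rw [ht]; rfl
  have h2 : ∀ a, (trivialMotion F t).2 a = 0 := fun a => by rw [ht]; rfl
  have of_body : Vn → t = 0 := fun a => Prod.ext (h1 (Sum.inl a)) (h2 a)
  obtain ⟨e⟩ := ‹Nonempty E›
  have hne := F.ends_ne e
  rcases hA : F.endA e with a | a
  · exact of_body a
  rcases hB : F.endB e with b | b
  · exact of_body b
  have hab : F.pos a ≠ F.pos b := fun h => hne (by rw [hA, hB, hinj h])
  have ha : t.1 + t.2 • Jrot (F.pos a) = 0 := h1 (Sum.inr a)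
  have hb : t.1 + t.2 • Jrot (F.pos b) = 0 := h1 (Sum.inr b)
  have ht2 : t.2 = 0 := by
    by_contra h0
    have h := smul_right_injective (ℝ × ℝ) h0 (add_left_cancel (ha.trans hb.symm))
    simp only [Jrot, Prod.mk.injEq, neg_inj] at h
    exact hab (Prod.ext h.2 h.1)
  refine Prod.ext ?_ ht2
  simpa [ht2] using ha

/-- A nonempty framework with independent bars has at most `3n + 2m − 3` bars. -/
lemma card_add_three_le_of_linearIndependent [Fintype Vn] [Fintype Vm] [Fintype E] [Nonempty E]
    (F : BodyBar Vn Vm E) (hinj : Function.Injective F.pos)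
    (hli : LinearIndependent ℝ (barFun F)) :
    Fintype.card E + 3 ≤ 3 * Fintype.card Vn + 2 * Fintype.card Vm := by
  set T := LinearMap.range (trivialMotion F) with hT
  have hmem : ∀ e, barLin F e ∈ T.dualAnnihilator := by
    intro e
    rw [Submodule.mem_dualAnnihilator]
    rintro _ ⟨t, rfl⟩
    exact barLin_trivialMotion F e t
  have hli' : LinearIndependent ℝ (barLin F) :=
    LinearIndependent.of_comp (LinearMap.ltoFun ℝ (Vel Vn Vm) ℝ ℝ) hli
  have hliT : LinearIndependent ℝ (fun e => (⟨barLin F e, hmem e⟩ : T.dualAnnihilator)) :=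
    LinearIndependent.of_comp T.dualAnnihilator.subtype hli'
  have hcard := hliT.fintype_card_le_finrank
  have hsum := Subspace.finrank_add_finrank_dualAnnihilator_eq T
  have hrange : Module.finrank ℝ T = 3 := by
    rw [hT, LinearMap.finrank_range_of_inj (trivialMotion_injective F hinj)]
    simp
  have hV : Module.finrank ℝ (Vel Vn Vm) = 3 * Fintype.card Vn + 2 * Fintype.card Vm := by
    simp [Module.finrank_prod, Module.finrank_pi_fintype]
    ring
  omega

lemma exists_sum_map_val_eq {α β : Type*} {s : Finset α} {t : Finset β} (x : α ⊕ β)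
    (hs : ∀ a, x = Sum.inl a → a ∈ s) (ht : ∀ b, x = Sum.inr b → b ∈ t) :
    ∃ y : s ⊕ t, Sum.map Subtype.val Subtype.val y = x := by
  rcases x with a | b
  · exact ⟨Sum.inl ⟨a, hs a rfl⟩, rfl⟩
  · exact ⟨Sum.inr ⟨b, ht b rfl⟩, rfl⟩

/-- The subframework formed by a set of bars and the nodes incident to them. -/
lemma exists_subframework [Fintype Vn] [Fintype Vm] (F : BodyBar Vn Vm E) (S : Finset E) :
    ∃ G : BodyBar (incN F.endA F.endB S) (incM F.endA F.endB S) S,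
      (∀ a, G.pos a = F.pos a) ∧
      (∀ e, Sum.map Subtype.val Subtype.val (G.endA e) = F.endA e) ∧
      (∀ e, Sum.map Subtype.val Subtype.val (G.endB e) = F.endB e) ∧
      (∀ e, G.jA e = F.jA e) ∧ (∀ e, G.jB e = F.jB e) := by
  have hA : ∀ e : S, ∃ y : incN F.endA F.endB S ⊕ incM F.endA F.endB S,
      Sum.map Subtype.val Subtype.val y = F.endA e := fun e =>
    exists_sum_map_val_eq _
      (fun a h => Finset.mem_filter.2 ⟨Finset.mem_univ _, e, e.2, Or.inl h⟩)
      (fun a h => Finset.mem_filter.2 ⟨Finset.mem_univ _, e, e.2, Or.inl h⟩)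
  have hB : ∀ e : S, ∃ y : incN F.endA F.endB S ⊕ incM F.endA F.endB S,
      Sum.map Subtype.val Subtype.val y = F.endB e := fun e =>
    exists_sum_map_val_eq _
      (fun a h => Finset.mem_filter.2 ⟨Finset.mem_univ _, e, e.2, Or.inr h⟩)
      (fun a h => Finset.mem_filter.2 ⟨Finset.mem_univ _, e, e.2, Or.inr h⟩)
  choose eA heA using hA
  choose eB heB using hB
  refine ⟨{ pos := fun a => F.pos a, endA := eA, endB := eB,
            jA := fun e => F.jA e, jB := fun e => F.jB e,
            ends_ne := fun e h => F.ends_ne e (by rw [← heA, ← heB, h]),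
            jA_pt := fun e a h => F.jA_pt e a (by rw [← heA, h]; rfl),
            jB_pt := fun e a h => F.jB_pt e a (by rw [← heB, h]; rfl) },
    fun _ => rfl, heA, heB, fun _ => rfl, fun _ => rfl⟩

/-- If a two-dimensional body-bar framework with exactly `K(n,m) = 3n + 2m − 3` bars
is rigid (and point-like bodies have pairwise distinct positions), then no nonempty
subset `E'` of bars has more than `3n' + 2m' − 3` bars, where `n'` and `m'` count the
bodies and point-like bodies incident to some bar of `E'`. -/
theorem rigid_isostatic_no_overcount [Fintype Vn] [Fintype Vm] [Fintype E]
    (F : BodyBar Vn Vm E)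
    (hcard : (Fintype.card E : ℤ) = 3 * Fintype.card Vn + 2 * Fintype.card Vm - 3)
    (hrig : IsRigid F)
    (hinj : Function.Injective F.pos) :
    ∀ E' : Finset E, E'.Nonempty →
      (E'.card : ℤ) ≤ 3 * (incN F.endA F.endB E').card + 2 * (incM F.endA F.endB E').card - 3 := by
  intro E' hE'
  have hli : LinearIndependent ℝ (barFun F) := by
    rw [linearIndependent_iff_card_eq_finrank_span]
    have h : (Fintype.card E : ℤ) = barRank F := by rw [hcard, hrig]
    exact_mod_cast h
  obtain ⟨G, hpos, heA, heB, hjA, hjB⟩ := exists_subframework F E'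
  have : Nonempty E' := hE'.to_subtype
  have hGinj : Function.Injective G.pos := fun a b h =>
    Subtype.ext (hinj (by rwa [hpos, hpos] at h))
  let restrict : Vel Vn Vm → Vel (incN F.endA F.endB E') (incM F.endA F.endB E') :=
    fun W => (fun a => W.1 (Sum.map Subtype.val Subtype.val a), fun a => W.2 a)
  have hang : ∀ W a, angVel (restrict W) a = angVel W (Sum.map Subtype.val Subtype.val a) := by
    rintro W (a | a) <;> rfl
  have hbar : LinearMap.funLeft ℝ ℝ restrict ∘ barFun G = fun e : E' => barFun F e := by
    funext e W
    simp only [Function.comp_apply, LinearMap.funLeft_apply, barFun, hang, heA, heB, hjA, hjB]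
    simp only [restrict, heA, heB]
  have hGli : LinearIndependent ℝ (barFun G) := by
    refine LinearIndependent.of_comp (LinearMap.funLeft ℝ ℝ restrict) ?_
    rw [hbar]
    exact hli.comp _ Subtype.val_injective
  have key := card_add_three_le_of_linearIndependent G hGinj hGli
  simp only [Fintype.card_coe] at key
  omega

end
end

section
/- Hendrickson's lemma (body-bar, combinatorial form). Let Ê be an edge set of a finite multigraph with non-trivial and point-like nodes such that for every edge f ∈ Ê, the multigraph obtained from Ê by quadrupling f has no nonempty edge subset E' with |E'| > 3n' + 2m'. Let e ∉ Ê be a new edge between two distinct nodes, and suppose the multigraph obtained from Ê ∪ {e} by quadrupling e has no nonempty edge subset E' with |E'| > 3n' + 2m'. Then for every edge f ∈ Ê ∪ {e}, the multigraph obtained from Ê ∪ {e} by quadrupling f has no nonempty edge subset E' with |E'| > 3n' + 2m'. -/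
open scoped Classical

set_option linter.unusedSectionVars false

noncomputable section

variable {Vn Vm : Type*}

/-- The vertex class `V2` of the bipartite graph `B(H)`: 3 copies of each non-trivial
node and 2 copies of each point-like node. -/
abbrev V2copies (Vn Vm : Type*) := Vn × Fin 3 ⊕ Vm × Fin 2

/-- The node underlying a copy in `V2`. -/
def nodeOf : V2copies Vn Vm → Vn ⊕ Vm :=
  Sum.elim (fun p => Sum.inl p.1) (fun p => Sum.inr p.1)

/-- A matching of the bipartite graph `B(H)` saturating the class `V1` (whose
vertices are the edges of the multigraph `H`): an injection assigning to each edge a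
copy of one of its two endpoints. -/
def SaturatingMatching {ε : Type*} (eA eB : ε → Vn ⊕ Vm) : Prop :=
  ∃ M : ε → V2copies Vn Vm, Function.Injective M ∧
    ∀ e, nodeOf (M e) = eA e ∨ nodeOf (M e) = eB e

/-- The multigraph obtained by quadrupling the edge `f` (adding 3 further parallel
copies of `f`) has no nonempty edge subset `E'` with `|E'| > 3n' + 2m'`. -/
def QuadOK [Fintype Vn] [Fintype Vm] {ε : Type*} (eA eB : ε → Vn ⊕ Vm) (f : ε) : Prop :=
  ∀ E' : Finset (ε ⊕ Fin 3), E'.Nonempty →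
    (E'.card : ℤ) ≤
      3 * (incN (Sum.elim eA fun _ => eA f) (Sum.elim eB fun _ => eB f) E').card +
      2 * (incM (Sum.elim eA fun _ => eA f) (Sum.elim eB fun _ => eB f) E').card

theorem incN_image [Fintype Vn] {ε δ : Type*} (eA eB : ε → Vn ⊕ Vm) (g : δ → ε)
    (S : Finset δ) :
    incN eA eB (S.image g) = incN (fun d => eA (g d)) (fun d => eB (g d)) S := by
  ext a
  simp [incN]

theorem incM_image [Fintype Vm] {ε δ : Type*} (eA eB : ε → Vn ⊕ Vm) (g : δ → ε)
    (S : Finset δ) :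
    incM eA eB (S.image g) = incM (fun d => eA (g d)) (fun d => eB (g d)) S := by
  ext a
  simp [incM]

/-- The edge of the original multigraph underlying an edge of the multigraph with `f`
quadrupled. -/
def unquad {ε : Type*} (f : ε) : ε ⊕ Fin 3 → ε :=
  Sum.elim id fun _ => f

theorem comp_unquad {ε α : Type*} (h : ε → α) (f : ε) :
    (Sum.elim h fun _ => h f) = fun x => h (unquad f x) := by
  ext (x | x) <;> rfl

theorem card_le_card_image_unquad {ε : Type*} (f : ε) (E' : Finset (ε ⊕ Fin 3)) :
    E'.card ≤ (E'.image (unquad f)).card + if f ∈ E'.image (unquad f) then 3 else 0 := by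
  have hle : E'.toLeft.card ≤ (E'.image (unquad f)).card :=
    Finset.card_le_card fun x hx =>
      Finset.mem_image.2 ⟨Sum.inl x, Finset.mem_toLeft.1 hx, rfl⟩
  have hcard := E'.card_toLeft_add_card_toRight
  split_ifs with hf
  · have hr : E'.toRight.card ≤ 3 := by simpa using Finset.card_le_univ E'.toRight
    omega
  · have hr : E'.toRight = ∅ := Finset.eq_empty_of_forall_notMem fun i hi =>
      hf (Finset.mem_image.2 ⟨Sum.inr i, Finset.mem_toRight.1 hi, rfl⟩)
    rw [hr, Finset.card_empty] at hcard
    omega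

/-- Quadrupling `f` amounts to counting `f` with weight four. -/
theorem quadOK_iff [Fintype Vn] [Fintype Vm] {ε : Type*} (eA eB : ε → Vn ⊕ Vm) (f : ε) :
    QuadOK eA eB f ↔ ∀ S : Finset ε, S.Nonempty →
      S.card + (if f ∈ S then 3 else 0) ≤
        3 * (incN eA eB S).card + 2 * (incM eA eB S).card := by
  unfold QuadOK
  simp only [comp_unquad, ← incN_image, ← incM_image]
  constructor
  · intro h S hS
    let E' : Finset (ε ⊕ Fin 3) := S.disjSum (if f ∈ S then Finset.univ else ∅)
    have himage : E'.image (unquad f) = S := by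
      ext x
      by_cases hf : f ∈ S <;> simp [E', hf, unquad]
      rintro rfl
      exact hf
    have hcard : E'.card = S.card + if f ∈ S then 3 else 0 := by
      by_cases hf : f ∈ S <;> simp [E', hf]
    have hE' := h E' (Finset.image_nonempty.1 (himage.symm ▸ hS))
    rw [himage, hcard] at hE'
    exact_mod_cast hE'
  · intro h E' hE'
    exact_mod_cast (card_le_card_image_unquad f E').trans (h _ (hE'.image _))

theorem quadOK_subtype_iff [Fintype Vn] [Fintype Vm] {ε : Type*} (eA eB : ε → Vn ⊕ Vm)
    (T : Finset ε) (f : {x // x ∈ T}) :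
    QuadOK (fun g : {x // x ∈ T} => eA g) (fun g => eB g) f ↔
      ∀ S ⊆ T, S.Nonempty → S.card + (if f.1 ∈ S then 3 else 0) ≤
        3 * (incN eA eB S).card + 2 * (incM eA eB S).card := by
  rw [quadOK_iff]
  simp only [← incN_image, ← incM_image]
  have hcard (S : Finset {x // x ∈ T}) : (S.image Subtype.val).card = S.card :=
    Finset.card_image_of_injective S Subtype.val_injective
  have hmem (S : Finset {x // x ∈ T}) : f.1 ∈ S.image Subtype.val ↔ f ∈ S :=
    Subtype.val_injective.mem_finset_image
  constructor
  · intro h S hST hS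
    obtain ⟨S, rfl⟩ : ∃ S' : Finset {x // x ∈ T}, S'.image Subtype.val = S :=
      ⟨S.subtype (· ∈ T), by
        ext x
        simpa using fun hx => hST hx⟩
    simp only [hcard, hmem]
    convert h S (Finset.image_nonempty.1 hS)
  · intro h S hS
    have hS' := h (S.image Subtype.val) (Finset.image_subset_iff.2 fun x _ => x.2) (hS.image _)
    simp only [hcard, hmem] at hS'
    convert hS'

/-- **Hendrickson's lemma (body-bar, combinatorial form).** Let `Ehat` be an edge set
such that quadrupling any edge `f ∈ Ehat` creates no nonempty subset `E'` with
`|E'| > 3n' + 2m'`. If a new edge `e ∉ Ehat` is such that quadrupling `e` in `Ehat ∪ {e}`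
also creates no such subset, then quadrupling any edge `f ∈ Ehat ∪ {e}` creates no such
subset. -/
theorem hendrickson_lemma [Fintype Vn] [Fintype Vm] {ε : Type*} [Fintype ε] [DecidableEq ε]
    (eA eB : ε → Vn ⊕ Vm) (hne : ∀ f, eA f ≠ eB f)
    (Ehat : Finset ε) (e : ε) (he : e ∉ Ehat)
    (hEhat : ∀ f : {x // x ∈ Ehat},
      QuadOK (fun g : {x // x ∈ Ehat} => eA g) (fun g => eB g) f)
    (he4 : QuadOK (fun g : {x // x ∈ insert e Ehat} => eA g) (fun g => eB g)
      ⟨e, Finset.mem_insert_self e Ehat⟩) :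
    ∀ f : {x // x ∈ insert e Ehat},
      QuadOK (fun g : {x // x ∈ insert e Ehat} => eA g) (fun g => eB g) f := by
  rintro ⟨f, hf⟩
  rw [quadOK_subtype_iff] at he4 ⊢
  intro S hS hSne
  by_cases heS : e ∈ S
  · have h := he4 S hS hSne
    rw [if_pos heS] at h
    exact le_trans (by split_ifs <;> omega) h
  · have hSE : S ⊆ Ehat := (Finset.subset_insert_iff_of_notMem heS).1 hS
    rcases Finset.mem_insert.1 hf with rfl | hf
    · rw [if_neg heS]
      exact (Nat.le_add_right _ _).trans (he4 S hS hSne)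
    · exact (quadOK_subtype_iff eA eB Ehat ⟨f, hf⟩).1 (hEhat ⟨f, hf⟩) S hSE hSne

end
end

section
/- Let G be a finite multigraph with non-trivial and point-like nodes such that every nonempty edge subset E' satisfies |E'| ≤ 3n' + 2m' − 3. Then for any edge e of G, the multigraph obtained from G by tripling e (adding 3 further parallel copies of e) has no nonempty edge subset E' with |E'| > 3n' + 2m'; consequently its bipartite graph has a complete matching from V1 to V2. -/
open scoped Classical

set_option linter.unusedSectionVars false

noncomputable section

variable {Vn Vm : Type*}

theorem incN_comp [Fintype Vn] {ε δ : Type*} (eA eB : ε → Vn ⊕ Vm) (π : δ → ε) (S : Finset δ) :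
    incN (eA ∘ π) (eB ∘ π) S = incN eA eB (S.image π) := by
  ext a
  simp [incN]

theorem incM_comp [Fintype Vm] {ε δ : Type*} (eA eB : ε → Vn ⊕ Vm) (π : δ → ε) (S : Finset δ) :
    incM (eA ∘ π) (eB ∘ π) S = incM eA eB (S.image π) := by
  ext a
  simp [incM]

theorem card_le_card_image_elim_add {ε : Type*} (e : ε) (k : ℕ) (S : Finset (ε ⊕ Fin k)) :
    S.card ≤ (S.image (Sum.elim id fun _ => e)).card + k := by
  have hleft : S.toLeft ⊆ S.image (Sum.elim id fun _ => e) := fun x hx =>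
    Finset.mem_image.2 ⟨Sum.inl x, Finset.mem_toLeft.1 hx, rfl⟩
  have hright : S.toRight.card ≤ k := by
    simpa using Finset.card_le_univ S.toRight
  rw [← S.card_toLeft_add_card_toRight]
  exact add_le_add (Finset.card_le_card hleft) hright

/-- The neighbours in `V2` of a set of edges are exactly the copies of the incident nodes. -/
theorem biUnion_copies_eq [Fintype Vn] [Fintype Vm] {ε : Type*} (eA eB : ε → Vn ⊕ Vm)
    (S : Finset ε) :
    (S.biUnion fun f => Finset.univ.filter fun c : V2copies Vn Vm =>
        nodeOf c = eA f ∨ nodeOf c = eB f) =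
      (incN eA eB S ×ˢ Finset.univ).disjSum (incM eA eB S ×ˢ Finset.univ) := by
  ext (⟨a, i⟩ | ⟨a, i⟩) <;> simp [incN, incM, nodeOf, eq_comm]

/-- Hall's theorem for the bipartite graph of a multigraph. -/
theorem saturatingMatching_of_card_le [Fintype Vn] [Fintype Vm] {ε : Type*}
    (eA eB : ε → Vn ⊕ Vm)
    (h : ∀ S : Finset ε, S.Nonempty →
      S.card ≤ 3 * (incN eA eB S).card + 2 * (incM eA eB S).card) :
    SaturatingMatching eA eB := by
  obtain ⟨M, hinj, hM⟩ := (Finset.all_card_le_biUnion_card_iff_exists_injective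
    fun f => Finset.univ.filter fun c : V2copies Vn Vm =>
      nodeOf c = eA f ∨ nodeOf c = eB f).1 fun S => by
    rcases S.eq_empty_or_nonempty with rfl | hS
    · simp
    · rw [biUnion_copies_eq, Finset.card_disjSum, Finset.card_product, Finset.card_product]
      simpa [mul_comm] using h S hS
  exact ⟨M, hinj, fun f => by simpa using hM f⟩

theorem quadOK_of_card_le [Fintype Vn] [Fintype Vm] {ε : Type*} (eA eB : ε → Vn ⊕ Vm)
    (hcount : ∀ E' : Finset ε, E'.Nonempty →
      (E'.card : ℤ) ≤ 3 * (incN eA eB E').card + 2 * (incM eA eB E').card - 3)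
    (e : ε) : QuadOK eA eB e := by
  intro E' hE'
  have hA : (Sum.elim eA fun _ : Fin 3 => eA e) = eA ∘ Sum.elim id fun _ => e := by
    rw [Sum.comp_elim]
    rfl
  have hB : (Sum.elim eB fun _ : Fin 3 => eB e) = eB ∘ Sum.elim id fun _ => e := by
    rw [Sum.comp_elim]
    rfl
  rw [hA, hB, incN_comp, incM_comp]
  have h₁ := card_le_card_image_elim_add e 3 E'
  have h₂ := hcount _ (hE'.image (Sum.elim id fun _ => e))
  lia

/-- If every nonempty edge subset `E'` of a multigraph `G` satisfies
`|E'| ≤ 3n' + 2m' − 3`, then for any edge `e` of `G` the multigraph obtained by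
tripling `e` (adding 3 further parallel copies of `e`) has no nonempty edge subset
`E'` with `|E'| > 3n' + 2m'`; consequently its bipartite graph has a complete
matching from `V1` to `V2`. -/
theorem tripled_count_and_matching [Fintype Vn] [Fintype Vm] {ε : Type*} [Fintype ε]
    (eA eB : ε → Vn ⊕ Vm) (hne : ∀ f, eA f ≠ eB f)
    (hcount : ∀ E' : Finset ε, E'.Nonempty →
      (E'.card : ℤ) ≤ 3 * (incN eA eB E').card + 2 * (incM eA eB E').card - 3)
    (e : ε) :
    QuadOK eA eB e ∧
    SaturatingMatching (Sum.elim eA fun _ : Fin 3 => eA e)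
      (Sum.elim eB fun _ : Fin 3 => eB e) := by
  have hquad := quadOK_of_card_le eA eB hcount e
  exact ⟨hquad, saturatingMatching_of_card_le _ _ fun S hS => by exact_mod_cast hquad S hS⟩

end
end

section
/- Let G be a finite multigraph with non-trivial and point-like nodes such that every nonempty edge subset E' satisfies |E'| ≤ 3n' + 2m' − 3, and let e be a new edge between two distinct nodes of G such that the multigraph obtained from G ∪ {e} by quadrupling e has some nonempty edge subset violating |E'| ≤ 3n' + 2m'. Then there exists a nonempty subset E' of the edges of G with |E'| = 3n' + 2m' − 3 (an isostatic subgraph) such that both endpoints of e are incident to edges of E'. -/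
open scoped Classical

set_option linter.unusedSectionVars false

noncomputable section

variable {Vn Vm : Type*}

theorem mem_incN [Fintype Vn] {ε : Type*} {eA eB : ε → Vn ⊕ Vm} {S : Finset ε} {x : Vn} :
    x ∈ incN eA eB S ↔ ∃ e ∈ S, eA e = Sum.inl x ∨ eB e = Sum.inl x := by
  simp [incN]

theorem mem_incM [Fintype Vm] {ε : Type*} {eA eB : ε → Vn ⊕ Vm} {S : Finset ε} {x : Vm} :
    x ∈ incM eA eB S ↔ ∃ e ∈ S, eA e = Sum.inr x ∨ eB e = Sum.inr x := by
  simp [incM]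

/-- Two distinct nodes have total weight at least 4, where non-trivial nodes weigh 3 and
point-like nodes weigh 2. -/
theorem four_le_weight_of_ne (N : Finset Vn) (M : Finset Vm) {a b : Vn ⊕ Vm} (hab : a ≠ b)
    (ha : a ∈ N.disjSum M) (hb : b ∈ N.disjSum M) : 4 ≤ 3 * N.card + 2 * M.card := by
  have h : 1 < (N.disjSum M).card := Finset.one_lt_card.2 ⟨a, ha, b, hb, hab⟩
  rw [Finset.card_disjSum] at h
  omega

/-- A node is incident to `S` iff it lies in the disjoint sum of the two incidence sets. -/
theorem mem_disjSum_inc [Fintype Vn] [Fintype Vm] {ε : Type*} {eA eB : ε → Vn ⊕ Vm}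
    {S : Finset ε} {v : Vn ⊕ Vm} :
    v ∈ (incN eA eB S).disjSum (incM eA eB S) ↔ ∃ e ∈ S, eA e = v ∨ eB e = v := by
  cases v <;> simp [mem_incN, mem_incM]

/-- If every nonempty edge subset of a multigraph `G` satisfies
`|E'| ≤ 3n' + 2m' − 3`, and adding a new edge `e` (between distinct nodes `a`, `b`)
and quadrupling it creates some nonempty subset violating `|E'| ≤ 3n' + 2m'`, then
`G` has a nonempty isostatic edge subset `E'` (i.e. `|E'| = 3n' + 2m' − 3`) to whose
edges both endpoints `a` and `b` of `e` are incident. -/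
theorem failed_quadruple_isostatic [Fintype Vn] [Fintype Vm] {ε : Type*} [Fintype ε]
    (eA eB : ε → Vn ⊕ Vm) (hne : ∀ f, eA f ≠ eB f)
    (hcount : ∀ E' : Finset ε, E'.Nonempty →
      (E'.card : ℤ) ≤ 3 * (incN eA eB E').card + 2 * (incM eA eB E').card - 3)
    (a b : Vn ⊕ Vm) (hab : a ≠ b)
    (hfail : ∃ E' : Finset (ε ⊕ Fin 4), E'.Nonempty ∧
      3 * ((incN (Sum.elim eA fun _ => a) (Sum.elim eB fun _ => b) E').card : ℤ) +
        2 * (incM (Sum.elim eA fun _ => a) (Sum.elim eB fun _ => b) E').card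
          < E'.card) :
    ∃ E' : Finset ε, E'.Nonempty ∧
      (E'.card : ℤ) = 3 * (incN eA eB E').card + 2 * (incM eA eB E').card - 3 ∧
      (∃ f ∈ E', eA f = a ∨ eB f = a) ∧
      (∃ f ∈ E', eA f = b ∨ eB f = b) := by
  obtain ⟨E, -, hE⟩ := hfail
  set A : ε ⊕ Fin 4 → Vn ⊕ Vm := Sum.elim eA fun _ => a
  set B : ε ⊕ Fin 4 → Vn ⊕ Vm := Sum.elim eB fun _ => b
  have hcard := Finset.card_toLeft_add_card_toRight (u := E)
  have hright : E.toRight.card ≤ 4 := by simpa using Finset.card_le_univ E.toRight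
  have hN : incN eA eB E.toLeft ⊆ incN A B E := by
    intro x hx
    obtain ⟨e, he, h⟩ := mem_incN.1 hx
    exact mem_incN.2 ⟨Sum.inl e, Finset.mem_toLeft.1 he, h⟩
  have hM : incM eA eB E.toLeft ⊆ incM A B E := by
    intro x hx
    obtain ⟨e, he, h⟩ := mem_incM.1 hx
    exact mem_incM.2 ⟨Sum.inl e, Finset.mem_toLeft.1 he, h⟩
  have hNc := Finset.card_le_card hN
  have hMc := Finset.card_le_card hM
  have hleft := hcount E.toLeft
  have hr : E.toRight.Nonempty := by
    by_contra hr
    rw [Finset.not_nonempty_iff_eq_empty] at hr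
    rw [hr, Finset.card_empty] at hcard
    have := hleft (Finset.card_pos.1 (by omega))
    omega
  obtain ⟨i, hi⟩ := hr
  rw [Finset.mem_toRight] at hi
  have ha : a ∈ (incN A B E).disjSum (incM A B E) := mem_disjSum_inc.2 ⟨_, hi, Or.inl rfl⟩
  have hb : b ∈ (incN A B E).disjSum (incM A B E) := mem_disjSum_inc.2 ⟨_, hi, Or.inr rfl⟩
  have hfour := four_le_weight_of_ne _ _ hab ha hb
  have hl : E.toLeft.Nonempty := Finset.card_pos.1 (by omega)
  have hle := hleft hl
  have hNeq := Finset.eq_of_subset_of_card_le hN (by omega)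
  have hMeq := Finset.eq_of_subset_of_card_le hM (by omega)
  rw [← hNeq, ← hMeq] at ha hb
  exact ⟨E.toLeft, hl, by omega, mem_disjSum_inc.1 ha, mem_disjSum_inc.1 hb⟩

end
end

section
/- Let M be an r × c matrix whose entries are polynomials in N variables with rational coefficients, and let α ∈ ℝ^N be a point whose coordinates are algebraically independent over ℚ. Then rank M(α) = max over x ∈ ℝ^N of rank M(x); that is, at a point with algebraically independent coordinates the matrix attains its maximum possible rank. -/
noncomputable section

namespace Matrix

/-- A matrix over a field has `rank` many linearly independent rows. -/
theorem exists_linearIndependent_row_submatrix {K m n : Type*} [Field K] [Finite m] [Fintype n]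
    (A : Matrix m n K) :
    ∃ f : Fin A.rank → m, LinearIndependent K (A.submatrix f id).row := by
  rw [A.rank_eq_finrank_span_row]
  obtain ⟨v, hv, -, hli⟩ := Submodule.exists_fun_fin_finrank_span_eq K (Set.range A.row)
  choose f hf using hv
  exact ⟨f, by simpa [← funext hf] using! hli⟩

/-- A matrix over a field has a nonzero minor of size equal to its rank. -/
theorem exists_det_submatrix_ne_zero {K m n : Type*} [Field K] [Fintype m] [Fintype n]
    (A : Matrix m n K) :
    ∃ (f : Fin A.rank → m) (g : Fin A.rank → n), (A.submatrix f g).det ≠ 0 := by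
  obtain ⟨f, hf⟩ := A.exists_linearIndependent_row_submatrix
  have hrank : (A.submatrix f id)ᵀ.rank = A.rank := by
    rw [rank_transpose, hf.rank_matrix, Fintype.card_fin]
  obtain ⟨g, hg⟩ := hrank ▸ (A.submatrix f id)ᵀ.exists_linearIndependent_row_submatrix
  refine ⟨f, g, ?_⟩
  rw [← det_transpose, ← isUnit_iff_ne_zero, ← isUnit_iff_isUnit_det]
  exact linearIndependent_rows_iff_isUnit.mp hg

/-- A nonzero minor of size `k` bounds the rank below by `k`. -/
theorem card_le_rank_of_det_submatrix_ne_zero {R m n k : Type*} [CommRing R] [IsDomain R]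
    [Fintype n] [Fintype k] [DecidableEq k] (A : Matrix m n R) (f : k → m) (g : k → n)
    (h : (A.submatrix f g).det ≠ 0) : Fintype.card k ≤ A.rank :=
  (rank_of_det_ne_zero h).symm.trans_le (A.rank_submatrix_le f g)

end Matrix

/-- Let `M` be an `r × c` matrix of polynomials in `N` variables with rational
coefficients, and let `α ∈ ℝ^N` have coordinates algebraically independent over `ℚ`.
Then the evaluated matrix attains its maximum possible rank at `α`:
`rank M(α) = max_x rank M(x)`. -/
theorem rank_max_at_algebraically_independent {N r c : ℕ}
    (P : Matrix (Fin r) (Fin c) (MvPolynomial (Fin N) ℚ))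
    (α : Fin N → ℝ) (hα : AlgebraicIndependent ℚ α) :
    ∀ x : Fin N → ℝ,
      (Matrix.of fun i j => MvPolynomial.aeval x (P i j)).rank ≤
        (Matrix.of fun i j => MvPolynomial.aeval α (P i j)).rank := by
  intro x
  obtain ⟨f, g, hdet⟩ :=
    (Matrix.of fun i j => MvPolynomial.aeval x (P i j)).exists_det_submatrix_ne_zero
  have aeval_minor (y : Fin N → ℝ) :
      MvPolynomial.aeval y (P.submatrix f g).det =
        ((Matrix.of fun i j => MvPolynomial.aeval y (P i j)).submatrix f g).det :=
    AlgHom.map_det _ _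
  have hminor : (P.submatrix f g).det ≠ 0 := by
    intro h
    rw [← aeval_minor, h, map_zero] at hdet
    exact hdet rfl
  rw [← map_ne_zero_iff _ (algebraicIndependent_iff_injective_aeval.mp hα), aeval_minor] at hminor
  simpa using Matrix.card_le_rank_of_det_submatrix_ne_zero _ f g hminor

end
end
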